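/- For every prime power q, the number of equivalence classes of rational functions of degree 2 in F_q(X) is 𝔑(q,2) = 2. -/

import Mathlib

open Polynomial

/-- The degree of a rational function `f = P/Q` (with `P, Q` coprime) is
`max (deg P) (deg Q)`. -/
noncomputable def ratDeg {F : Type*} [Field F] (f : RatFunc F) : ℕ :=
  max f.num.natDegree f.denom.natDegree

/-- Composition (substitution) of rational functions: `(rcomp f g)(X) = f(g(X))`. -/
noncomputable def rcomp {F : Type*} [Field F] (f g : RatFunc F) : RatFunc F :=
  Polynomial.aeval g f.num / Polynomial.aeval g f.denom

/-- The number of equivalence classes of rational functions of degree `n` over `F`,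
where `f ~ g` iff `g = φ ∘ f ∘ ψ` for degree-one rational functions `φ, ψ`. -/
noncomputable def ratEquivCount (F : Type*) [Field F] (n : ℕ) : ℕ :=
  Nat.card (Quot (fun f g : {f : RatFunc F // ratDeg f = n} =>
    ∃ φ ψ : RatFunc F, ratDeg φ = 1 ∧ ratDeg ψ = 1 ∧
      (g : RatFunc F) = rcomp φ (rcomp (f : RatFunc F) ψ)))

section DegreeOneAndTwo

variable {F : Type*} [Field F]

lemma rcomp_div (P Q : F[X]) (g : RatFunc F) (hQ : aeval g Q ≠ 0) :
    rcomp (algebraMap F[X] (RatFunc F) P / algebraMap F[X] (RatFunc F) Q) g =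
      aeval g P / aeval g Q := by
  have hQ0 : Q ≠ 0 := by rintro rfl; simp at hQ
  have hmul := (RatFunc.num_div_denom
    (algebraMap F[X] (RatFunc F) P / algebraMap F[X] (RatFunc F) Q))
  obtain ⟨k, hk⟩ := RatFunc.denom_div_dvd P Q
  set f := algebraMap F[X] (RatFunc F) P / algebraMap F[X] (RatFunc F) Q with hf
  have hP : P * f.denom = f.num * Q := by
    apply RatFunc.algebraMap_injective F
    have h1 := RatFunc.algebraMap_ne_zero hQ0
    have h2 := RatFunc.algebraMap_ne_zero f.denom_ne_zero
    rw [map_mul, map_mul]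
    rw [hf, div_eq_div_iff h2 h1] at hmul
    exact hmul.symm
  have hd : aeval g f.denom ≠ 0 := by
    intro h0
    rw [hk, map_mul, h0, zero_mul] at hQ
    exact hQ rfl
  rw [rcomp, div_eq_div_iff hd hQ, ← map_mul, ← map_mul, hP]

lemma exists_scalar_of_isCoprime (P Q : F[X]) (hQ : Q ≠ 0) (h : IsCoprime P Q) :
    ∃ t : F, t ≠ 0 ∧
      P = C t * (algebraMap F[X] (RatFunc F) P / algebraMap F[X] (RatFunc F) Q).num ∧
      Q = C t * (algebraMap F[X] (RatFunc F) P / algebraMap F[X] (RatFunc F) Q).denom := by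
  have hmul := (RatFunc.num_div_denom
    (algebraMap F[X] (RatFunc F) P / algebraMap F[X] (RatFunc F) Q))
  obtain ⟨k, hk⟩ := RatFunc.denom_div_dvd P Q
  set f := algebraMap F[X] (RatFunc F) P / algebraMap F[X] (RatFunc F) Q with hf
  have hP : P = f.num * k := by
    apply RatFunc.algebraMap_injective F
    have h1 := RatFunc.algebraMap_ne_zero hQ
    have h2 := RatFunc.algebraMap_ne_zero f.denom_ne_zero
    have h3 := congrArg (algebraMap F[X] (RatFunc F)) hk
    rw [hf, div_eq_div_iff h2 h1] at hmul
    rw [← hf, h3] at hmul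
    rw [map_mul] at hmul ⊢
    apply mul_right_cancel₀ h2
    rw [← hmul]; ring
  have hu : IsUnit k := h.isUnit_of_dvd' ⟨_, hP.trans (mul_comm _ _)⟩ ⟨_, hk.trans (mul_comm _ _)⟩
  obtain ⟨t, ht, rfl⟩ := Polynomial.isUnit_iff.1 hu
  exact ⟨t, ht.ne_zero, hP.trans (mul_comm _ _), hk.trans (mul_comm _ _)⟩

lemma ratDeg_div_of_isCoprime (P Q : F[X]) (hQ : Q ≠ 0) (h : IsCoprime P Q) :
    ratDeg (algebraMap F[X] (RatFunc F) P / algebraMap F[X] (RatFunc F) Q) =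
      max P.natDegree Q.natDegree := by
  obtain ⟨t, ht, hP, hQ⟩ := exists_scalar_of_isCoprime P Q hQ h
  have hP' := congrArg natDegree hP
  have hQ' := congrArg natDegree hQ
  rw [natDegree_C_mul ht] at hP' hQ'
  rw [hP', hQ', ratDeg]

/-- The rational function `(aX + b) / (cX + d)`. -/
noncomputable def linRat (a b c d : F) : RatFunc F :=
  algebraMap F[X] (RatFunc F) (C a * X + C b) / algebraMap F[X] (RatFunc F) (C c * X + C d)

/-- The rational function `(aX² + bX + c) / (dX² + eX + f)`. -/
noncomputable def quadRat (a b c d e f : F) : RatFunc F :=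
  algebraMap F[X] (RatFunc F) (C a * X ^ 2 + C b * X + C c) /
    algebraMap F[X] (RatFunc F) (C d * X ^ 2 + C e * X + C f)

/-- The resultant of `aX² + bX + c` and `dX² + eX + f`. -/
def quadRes (a b c d e f : F) : F :=
  (a * f - c * d) ^ 2 - (a * e - b * d) * (b * f - c * e)

lemma linear_ne_zero {c d : F} (h : ¬ (c = 0 ∧ d = 0)) : C c * X + C d ≠ 0 := by
  intro h0
  exact h ⟨by simpa using congrArg (coeff · 1) h0, by simpa using congrArg (coeff · 0) h0⟩

lemma quadratic_ne_zero {a b c : F} (h : ¬ (a = 0 ∧ b = 0 ∧ c = 0)) :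
    C a * X ^ 2 + C b * X + C c ≠ 0 := by
  intro h0
  refine h ⟨?_, ?_, ?_⟩
  · simpa [coeff_X, coeff_C] using congrArg (coeff · 2) h0
  · simpa [coeff_X, coeff_C] using congrArg (coeff · 1) h0
  · simpa [coeff_X, coeff_C] using congrArg (coeff · 0) h0

lemma isCoprime_of_combination {P Q u v : F[X]} {t : F} (ht : t ≠ 0)
    (h : u * P + v * Q = C t) : IsCoprime P Q := by
  refine ⟨C t⁻¹ * u, C t⁻¹ * v, ?_⟩
  have : C t⁻¹ * C t = (1 : F[X]) := by rw [← C_mul, inv_mul_cancel₀ ht, C_1]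
  rw [← this, ← h]; ring

lemma isCoprime_linear {a b c d : F} (h : a * d - b * c ≠ 0) :
    IsCoprime (C a * X + C b) (C c * X + C d) := by
  refine isCoprime_of_combination (u := - C c) (v := C a) h ?_
  simp only [C_sub, C_mul]; ring

lemma isCoprime_quadratic {a b c d e f : F} (h : quadRes a b c d e f ≠ 0) :
    IsCoprime (C a * X ^ 2 + C b * X + C c) (C d * X ^ 2 + C e * X + C f) := by
  refine isCoprime_of_combination
    (u := - C ((a * f - c * d) * d) + C (a * e - b * d) * (C d * X + C e))
    (v := C ((a * f - c * d) * a) - C (a * e - b * d) * (C a * X + C b)) h ?_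
  simp only [quadRes, C_sub, C_mul, C_pow]; ring

lemma quadratic_denom_ne_zero {a b c d e f : F} (h : quadRes a b c d e f ≠ 0) :
    C d * X ^ 2 + C e * X + C f ≠ 0 := by
  apply quadratic_ne_zero
  rintro ⟨rfl, rfl, rfl⟩
  exact h (by simp [quadRes])

lemma ratDeg_quadRat {a b c d e f : F} (h : quadRes a b c d e f ≠ 0) :
    ratDeg (quadRat a b c d e f) = 2 := by
  rw [quadRat, ratDeg_div_of_isCoprime _ _ (quadratic_denom_ne_zero h) (isCoprime_quadratic h)]
  have h1 := natDegree_quadratic_le (a := a) (b := b) (c := c)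
  have h2 := natDegree_quadratic_le (a := d) (b := e) (c := f)
  by_cases ha : a = 0
  · have hd : d ≠ 0 := by rintro rfl; exact h (by simp [quadRes, ha])
    rw [natDegree_quadratic hd]; omega
  · rw [natDegree_quadratic ha]; omega

lemma ratDeg_linRat {a b c d : F} (h : a * d - b * c ≠ 0) : ratDeg (linRat a b c d) = 1 := by
  have h0 : ¬ (c = 0 ∧ d = 0) := by rintro ⟨rfl, rfl⟩; simp at h
  rw [linRat, ratDeg_div_of_isCoprime _ _ (linear_ne_zero h0) (isCoprime_linear h)]
  have h1 := natDegree_linear_le (a := a) (b := b)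
  have h2 := natDegree_linear_le (a := c) (b := d)
  by_cases ha : a = 0
  · have hc : c ≠ 0 := by rintro rfl; simp [ha] at h
    rw [natDegree_linear hc]; omega
  · rw [natDegree_linear ha]; omega

/-- Coprime polynomials which are linearly dependent are constant. -/
lemma natDegree_eq_zero_of_dependent {P Q : F[X]} (h : IsCoprime P Q) {a d : F}
    (had : ¬ (a = 0 ∧ d = 0)) (hPQ : C a * Q = C d * P) : max P.natDegree Q.natDegree = 0 := by
  have aux : ∀ {P Q : F[X]} {a d : F}, IsCoprime P Q → a ≠ 0 → C a * Q = C d * P →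
      P.natDegree = 0 ∧ Q.natDegree = 0 := by
    intro P Q a d h ha hPQ
    have hQ : Q = C (a⁻¹ * d) * P := by
      rw [C_mul, mul_assoc, ← hPQ, ← mul_assoc, ← C_mul, inv_mul_cancel₀ ha, C_1, one_mul]
    have hP : P.natDegree = 0 :=
      natDegree_eq_zero_of_isUnit (h.isUnit_of_dvd' dvd_rfl ⟨_, hQ.trans (mul_comm _ _)⟩)
    refine ⟨hP, ?_⟩
    have := natDegree_C_mul_le (a⁻¹ * d) P
    rw [← hQ] at this; omega
  by_cases ha : a = 0
  · have := aux h.symm (fun hd => had ⟨ha, hd⟩) hPQ.symm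
    omega
  · have := aux h ha hPQ
    omega

lemma exists_linRat_of_ratDeg {φ : RatFunc F} (h : ratDeg φ = 1) :
    ∃ a b c d : F, a * d - b * c ≠ 0 ∧ φ = linRat a b c d := by
  have hcop := φ.isCoprime_num_denom
  have hnd := φ.num_div_denom
  rw [ratDeg] at h
  obtain ⟨a, b, hP⟩ := exists_eq_X_add_C_of_natDegree_le_one (p := φ.num) (by omega)
  obtain ⟨c, d, hQ⟩ := exists_eq_X_add_C_of_natDegree_le_one (p := φ.denom) (by omega)
  refine ⟨a, b, c, d, fun h0 => ?_, by rw [linRat, ← hP, ← hQ, hnd]⟩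
  have hac : ¬ (a = 0 ∧ c = 0) := by
    rintro ⟨rfl, rfl⟩
    rw [hP, hQ] at h
    simp at h
  have := natDegree_eq_zero_of_dependent hcop hac (by
    rw [hP, hQ]
    have := congrArg (C (R := F)) h0
    simp only [C_sub, C_mul, C_0] at this
    linear_combination this)
  omega

lemma exists_quadRat_of_ratDeg {g : RatFunc F} (h : ratDeg g = 2) :
    ∃ a b c d e f : F, quadRes a b c d e f ≠ 0 ∧ g = quadRat a b c d e f := by
  have hcop := g.isCoprime_num_denom
  have hnd := g.num_div_denom
  rw [ratDeg] at h
  have key : ∀ p : F[X], p.natDegree ≤ 2 →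
      p = C (p.coeff 2) * X ^ 2 + C (p.coeff 1) * X + C (p.coeff 0) := by
    intro p hp
    conv_lhs => rw [as_sum_range_C_mul_X_pow' (n := 3) p (by omega)]
    simp only [Finset.sum_range_succ, Finset.sum_range_zero]
    ring
  have hP := key g.num (by omega)
  have hQ := key g.denom (by omega)
  generalize g.num.coeff 2 = a at hP
  generalize g.num.coeff 1 = b at hP
  generalize g.num.coeff 0 = c at hP
  generalize g.denom.coeff 2 = d at hQ
  generalize g.denom.coeff 1 = e at hQ
  generalize g.denom.coeff 0 = f at hQ
  refine ⟨a, b, c, d, e, f, fun h0 => ?_, by rw [quadRat, ← hP, ← hQ, hnd]⟩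
  have had : ¬ (a = 0 ∧ d = 0) := by
    rintro ⟨rfl, rfl⟩
    have h1 := natDegree_linear_le (a := b) (b := c)
    have h2 := natDegree_linear_le (a := e) (b := f)
    rw [hP, hQ] at h
    simp only [C_0, zero_mul, zero_add] at h
    omega
  have hps : a * e - b * d = 0 ∧ a * f - c * d = 0 := by
    have hres := congrArg (C (R := F)) h0
    simp only [quadRes, C_sub, C_mul, C_pow, C_0] at hres
    generalize hp : a * e - b * d = p
    generalize hs : a * f - c * d = s
    -- a nonzero multiple of a quadratic polynomial is not linear
    have aux : ∀ {x y z : F}, x ≠ 0 →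
        C x * X ^ 2 + C y * X + C z ∣ C (p * x) * X + C (p * y - s * x) → p = 0 ∧ s = 0 := by
      intro x y z hx hdvd
      have hdeg := natDegree_quadratic (b := y) (c := z) hx
      have hzero := eq_zero_of_dvd_of_natDegree_lt hdvd
        (by rw [hdeg]; exact natDegree_linear_le.trans_lt one_lt_two)
      have h1 : p * x = 0 := by simpa using congrArg (coeff · 1) hzero
      have h2 : p * y - s * x = 0 := by simpa using congrArg (coeff · 0) hzero
      have hp0 : p = 0 := (mul_eq_zero.1 h1).resolve_right hx
      refine ⟨hp0, ?_⟩
      simpa [hp0, hx] using h2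
    by_cases ha : a = 0
    · have hd : d ≠ 0 := fun hd => had ⟨ha, hd⟩
      apply aux hd (y := e) (z := f)
      rw [← hQ]
      refine hcop.symm.dvd_of_dvd_mul_right
        ⟨C (p * a) * X + C (p * b - s * a), ?_⟩
      rw [hP, hQ, ← hp, ← hs]
      simp only [C_sub, C_mul]
      linear_combination hres
    · apply aux ha (y := b) (z := c)
      rw [← hP]
      refine hcop.dvd_of_dvd_mul_right
        ⟨C (p * d) * X + C (p * e - s * d), ?_⟩
      rw [hP, hQ, ← hp, ← hs]
      simp only [C_sub, C_mul]
      linear_combination -hres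
  have := natDegree_eq_zero_of_dependent hcop had (by
    rw [hP, hQ]
    have h1 := congrArg (C (R := F)) hps.1
    have h2 := congrArg (C (R := F)) hps.2
    simp only [C_sub, C_mul, C_0] at h1 h2
    linear_combination h1 * X + h2)
  omega

lemma quadRes_comp_right_ne_zero {α β γ δ a b c d e f : F} (hdet : α * δ - β * γ ≠ 0)
    (h : quadRes a b c d e f ≠ 0) :
    quadRes (a * α ^ 2 + b * α * γ + c * γ ^ 2)
        (2 * a * α * β + b * (α * δ + β * γ) + 2 * c * γ * δ)
        (a * β ^ 2 + b * β * δ + c * δ ^ 2)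
        (d * α ^ 2 + e * α * γ + f * γ ^ 2)
        (2 * d * α * β + e * (α * δ + β * γ) + 2 * f * γ * δ)
        (d * β ^ 2 + e * β * δ + f * δ ^ 2) ≠ 0 := by
  convert mul_ne_zero (pow_ne_zero 4 hdet) h using 1
  simp only [quadRes]; ring

lemma quadRes_comp_left_ne_zero {α β γ δ a b c d e f : F} (hdet : α * δ - β * γ ≠ 0)
    (h : quadRes a b c d e f ≠ 0) :
    quadRes (α * a + β * d) (α * b + β * e) (α * c + β * f)
        (γ * a + δ * d) (γ * b + δ * e) (γ * c + δ * f) ≠ 0 := by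
  convert mul_ne_zero (pow_ne_zero 2 hdet) h using 1
  simp only [quadRes]; ring

lemma algebraMap_C_eq (t : F) :
    algebraMap F[X] (RatFunc F) (C t) = algebraMap F (RatFunc F) t := by
  rw [RatFunc.algebraMap_C, RatFunc.algebraMap_eq_C]

lemma rcomp_linRat_quadRat {α β γ δ a b c d e f : F} (hdet : α * δ - β * γ ≠ 0)
    (h : quadRes a b c d e f ≠ 0) :
    rcomp (linRat α β γ δ) (quadRat a b c d e f) =
      quadRat (α * a + β * d) (α * b + β * e) (α * c + β * f)
        (γ * a + δ * d) (γ * b + δ * e) (γ * c + δ * f) := by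
  have hres := quadRes_comp_left_ne_zero hdet h
  have hQ := RatFunc.algebraMap_ne_zero (quadratic_denom_ne_zero h)
  have hQ' := RatFunc.algebraMap_ne_zero (quadratic_denom_ne_zero hres)
  have key : ∀ s t : F, aeval (quadRat a b c d e f) (C s * X + C t) =
      algebraMap F[X] (RatFunc F)
          (C (s * a + t * d) * X ^ 2 + C (s * b + t * e) * X + C (s * c + t * f)) /
        algebraMap F[X] (RatFunc F) (C d * X ^ 2 + C e * X + C f) := by
    intro s t
    have hsub : quadRat a b c d e f * algebraMap F[X] (RatFunc F)
        (C d * X ^ 2 + C e * X + C f) =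
          algebraMap F[X] (RatFunc F) (C a * X ^ 2 + C b * X + C c) := div_mul_cancel₀ _ hQ
    rw [eq_div_iff hQ]
    simp only [map_add, map_mul, map_pow, aeval_C, aeval_X, algebraMap_C_eq] at hsub ⊢
    linear_combination algebraMap F (RatFunc F) s * hsub
  rw [linRat, rcomp_div, key, key, div_div_div_cancel_right₀ hQ, quadRat]
  rw [key]
  exact div_ne_zero hQ' hQ

lemma rcomp_quadRat_linRat {α β γ δ a b c d e f : F} (hdet : α * δ - β * γ ≠ 0)
    (h : quadRes a b c d e f ≠ 0) :
    rcomp (quadRat a b c d e f) (linRat α β γ δ) =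
      quadRat (a * α ^ 2 + b * α * γ + c * γ ^ 2)
        (2 * a * α * β + b * (α * δ + β * γ) + 2 * c * γ * δ)
        (a * β ^ 2 + b * β * δ + c * δ ^ 2)
        (d * α ^ 2 + e * α * γ + f * γ ^ 2)
        (2 * d * α * β + e * (α * δ + β * γ) + 2 * f * γ * δ)
        (d * β ^ 2 + e * β * δ + f * δ ^ 2) := by
  have hres := quadRes_comp_right_ne_zero hdet h
  have h0 : ¬ (γ = 0 ∧ δ = 0) := by rintro ⟨rfl, rfl⟩; simp at hdet
  have hL := RatFunc.algebraMap_ne_zero (linear_ne_zero h0)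
  have hQ' := RatFunc.algebraMap_ne_zero (quadratic_denom_ne_zero hres)
  have key : ∀ r s t : F, aeval (linRat α β γ δ) (C r * X ^ 2 + C s * X + C t) =
      algebraMap F[X] (RatFunc F)
          (C (r * α ^ 2 + s * α * γ + t * γ ^ 2) * X ^ 2 +
            C (2 * r * α * β + s * (α * δ + β * γ) + 2 * t * γ * δ) * X +
            C (r * β ^ 2 + s * β * δ + t * δ ^ 2)) /
        algebraMap F[X] (RatFunc F) (C γ * X + C δ) ^ 2 := by
    intro r s t
    have hsub : linRat α β γ δ * algebraMap F[X] (RatFunc F) (C γ * X + C δ) =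
        algebraMap F[X] (RatFunc F) (C α * X + C β) := div_mul_cancel₀ _ hL
    rw [eq_div_iff (pow_ne_zero 2 hL)]
    simp only [map_add, map_mul, map_pow, aeval_C, aeval_X, algebraMap_C_eq] at hsub ⊢
    simp only [map_ofNat]
    generalize linRat α β γ δ = g at *
    generalize algebraMap F[X] (RatFunc F) X = x at *
    generalize algebraMap F (RatFunc F) α = A at *
    generalize algebraMap F (RatFunc F) β = B at *
    generalize algebraMap F (RatFunc F) γ = G at *
    generalize algebraMap F (RatFunc F) δ = D at *
    generalize algebraMap F (RatFunc F) r = R at *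
    generalize algebraMap F (RatFunc F) s = S at *
    linear_combination (R * (g * (G * x + D) + (A * x + B)) + S * (G * x + D)) * hsub
  rw [quadRat, rcomp_div, key, key, div_div_div_cancel_right₀ (pow_ne_zero 2 hL), quadRat]
  rw [key]
  exact div_ne_zero hQ' (pow_ne_zero 2 hL)

/-- Two presentations of the same rational function are proportional. -/
lemma quadRat_eq_quadRat {a b c d e f a' b' c' d' e' f' : F} (h : quadRes a b c d e f ≠ 0)
    (h' : quadRes a' b' c' d' e' f' ≠ 0)
    (heq : quadRat a b c d e f = quadRat a' b' c' d' e' f') :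
    ∃ t : F, t ≠ 0 ∧ a' = t * a ∧ b' = t * b ∧ c' = t * c ∧
      d' = t * d ∧ e' = t * e ∧ f' = t * f := by
  obtain ⟨u, hu, hP, hQ⟩ := exists_scalar_of_isCoprime _ _ (quadratic_denom_ne_zero h)
    (isCoprime_quadratic h)
  obtain ⟨v, hv, hP', hQ'⟩ := exists_scalar_of_isCoprime _ _ (quadratic_denom_ne_zero h')
    (isCoprime_quadratic h')
  rw [quadRat, quadRat] at heq
  rw [← heq] at hP' hQ'
  have key : ∀ {x y z x' y' z' : F} {N : F[X]}, C x * X ^ 2 + C y * X + C z = C u * N →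
      C x' * X ^ 2 + C y' * X + C z' = C v * N →
      x' = v * u⁻¹ * x ∧ y' = v * u⁻¹ * y ∧ z' = v * u⁻¹ * z := by
    intro x y z x' y' z' N hN hN'
    have coe : ∀ {p q r k : F}, C p * X ^ 2 + C q * X + C r = C k * N →
        p = k * N.coeff 2 ∧ q = k * N.coeff 1 ∧ r = k * N.coeff 0 := by
      intro p q r k hk
      refine ⟨?_, ?_, ?_⟩
      · simpa [coeff_X, coeff_C] using congrArg (coeff · 2) hk
      · simpa [coeff_X, coeff_C] using congrArg (coeff · 1) hk
      · simpa [coeff_X, coeff_C] using congrArg (coeff · 0) hk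
    obtain ⟨h1, h2, h3⟩ := coe hN
    obtain ⟨h1', h2', h3'⟩ := coe hN'
    rw [h1, h2, h3, h1', h2', h3']
    refine ⟨?_, ?_, ?_⟩ <;> field_simp
  obtain ⟨h1, h2, h3⟩ := key hP hP'
  obtain ⟨h4, h5, h6⟩ := key hQ hQ'
  exact ⟨v * u⁻¹, mul_ne_zero hv (inv_ne_zero hu), h1, h2, h3, h4, h5, h6⟩

/-- A condition on the coefficients of a quadratic rational function which singles out the
equivalence class of `X²`: its two ramification points are rational, and in characteristic two it
is ramified everywhere. -/
def IsMonomialCoeffs (a b c d e f : F) : Prop :=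
  IsSquare (quadRes a b c d e f) ∧
    ((2 : F) = 0 → a * e - b * d = 0 ∧ b * f - c * e = 0)

lemma isSquare_sq_mul_iff {u : F} (hu : u ≠ 0) (x : F) : IsSquare (u ^ 2 * x) ↔ IsSquare x := by
  refine ⟨fun h => ?_, fun h => (IsSquare.sq u).mul h⟩
  have := (IsSquare.sq u⁻¹).mul h
  rwa [← mul_assoc, ← mul_pow, inv_mul_cancel₀ hu, one_pow, one_mul] at this

lemma isMonomialCoeffs_smul {t : F} (ht : t ≠ 0) (a b c d e f : F) :
    IsMonomialCoeffs (t * a) (t * b) (t * c) (t * d) (t * e) (t * f) ↔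
      IsMonomialCoeffs a b c d e f := by
  have h1 : quadRes (t * a) (t * b) (t * c) (t * d) (t * e) (t * f) =
      (t ^ 2) ^ 2 * quadRes a b c d e f := by simp only [quadRes]; ring
  have h2 : t * a * (t * e) - t * b * (t * d) = t ^ 2 * (a * e - b * d) := by ring
  have h3 : t * b * (t * f) - t * c * (t * e) = t ^ 2 * (b * f - c * e) := by ring
  have ht2 := pow_ne_zero 2 ht
  simp only [IsMonomialCoeffs, h1, h2, h3, isSquare_sq_mul_iff ht2, mul_eq_zero, ht2, false_or]

lemma isMonomialCoeffs_comp_left {α β γ δ : F} (hdet : α * δ - β * γ ≠ 0) (a b c d e f : F) :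
    IsMonomialCoeffs (α * a + β * d) (α * b + β * e) (α * c + β * f)
        (γ * a + δ * d) (γ * b + δ * e) (γ * c + δ * f) ↔
      IsMonomialCoeffs a b c d e f := by
  have h1 : quadRes (α * a + β * d) (α * b + β * e) (α * c + β * f)
        (γ * a + δ * d) (γ * b + δ * e) (γ * c + δ * f) =
      (α * δ - β * γ) ^ 2 * quadRes a b c d e f := by simp only [quadRes]; ring
  have h2 : (α * a + β * d) * (γ * b + δ * e) - (α * b + β * e) * (γ * a + δ * d) =
    (α * δ - β * γ) * (a * e - b * d) := by ring
  have h3 : (α * b + β * e) * (γ * c + δ * f) - (α * c + β * f) * (γ * b + δ * e) =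
    (α * δ - β * γ) * (b * f - c * e) := by ring
  simp only [IsMonomialCoeffs, h1, h2, h3, isSquare_sq_mul_iff hdet, mul_eq_zero, hdet, false_or]

lemma isMonomialCoeffs_comp_right {α β γ δ : F} (hdet : α * δ - β * γ ≠ 0) (a b c d e f : F) :
    IsMonomialCoeffs (a * α ^ 2 + b * α * γ + c * γ ^ 2)
        (2 * a * α * β + b * (α * δ + β * γ) + 2 * c * γ * δ)
        (a * β ^ 2 + b * β * δ + c * δ ^ 2)
        (d * α ^ 2 + e * α * γ + f * γ ^ 2)
        (2 * d * α * β + e * (α * δ + β * γ) + 2 * f * γ * δ)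
        (d * β ^ 2 + e * β * δ + f * δ ^ 2) ↔
      IsMonomialCoeffs a b c d e f := by
  have h1 : quadRes (a * α ^ 2 + b * α * γ + c * γ ^ 2)
        (2 * a * α * β + b * (α * δ + β * γ) + 2 * c * γ * δ)
        (a * β ^ 2 + b * β * δ + c * δ ^ 2)
        (d * α ^ 2 + e * α * γ + f * γ ^ 2)
        (2 * d * α * β + e * (α * δ + β * γ) + 2 * f * γ * δ)
        (d * β ^ 2 + e * β * δ + f * δ ^ 2) =
      ((α * δ - β * γ) ^ 2) ^ 2 * quadRes a b c d e f := by simp only [quadRes]; ring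
  simp only [IsMonomialCoeffs, h1, isSquare_sq_mul_iff (pow_ne_zero 2 hdet)]
  refine and_congr_right fun _ => forall_congr' fun h20 => ?_
  have hp : (a * α ^ 2 + b * α * γ + c * γ ^ 2) *
        (2 * d * α * β + e * (α * δ + β * γ) + 2 * f * γ * δ) -
      (2 * a * α * β + b * (α * δ + β * γ) + 2 * c * γ * δ) *
        (d * α ^ 2 + e * α * γ + f * γ ^ 2) =
      (α * δ - β * γ) * ((a * e - b * d) * α ^ 2 + (b * f - c * e) * γ ^ 2) := by
    linear_combination (α * δ - β * γ) * (a * f - c * d) * α * γ * h20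
  have hr : (2 * a * α * β + b * (α * δ + β * γ) + 2 * c * γ * δ) *
        (d * β ^ 2 + e * β * δ + f * δ ^ 2) -
      (a * β ^ 2 + b * β * δ + c * δ ^ 2) *
        (2 * d * α * β + e * (α * δ + β * γ) + 2 * f * γ * δ) =
      (α * δ - β * γ) * ((a * e - b * d) * β ^ 2 + (b * f - c * e) * δ ^ 2) := by
    linear_combination (α * δ - β * γ) * (a * f - c * d) * β * δ * h20
  simp only [hp, hr, mul_eq_zero, hdet, false_or]
  generalize a * e - b * d = p
  generalize b * f - c * e = r
  constructor
  · rintro ⟨hp, hr⟩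
    have hdet2 := pow_ne_zero 2 hdet
    refine ⟨(mul_eq_zero.1 ?_).resolve_left hdet2, (mul_eq_zero.1 ?_).resolve_left hdet2⟩
    · linear_combination δ ^ 2 * hp - γ ^ 2 * hr - β * γ * (α * δ - β * γ) * p * h20
    · linear_combination α ^ 2 * hr - β ^ 2 * hp - β * γ * (α * δ - β * γ) * r * h20
  · rintro ⟨rfl, rfl⟩
    simp

/-- Being represented by coefficients satisfying `IsMonomialCoeffs`. -/
def IsMonomialType (g : RatFunc F) : Prop :=
  ∃ a b c d e f : F, quadRes a b c d e f ≠ 0 ∧ g = quadRat a b c d e f ∧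
    IsMonomialCoeffs a b c d e f

lemma isMonomialType_quadRat {a b c d e f : F} (h : quadRes a b c d e f ≠ 0) :
    IsMonomialType (quadRat a b c d e f) ↔ IsMonomialCoeffs a b c d e f := by
  refine ⟨?_, fun hm => ⟨a, b, c, d, e, f, h, rfl, hm⟩⟩
  rintro ⟨a', b', c', d', e', f', h', heq, hm⟩
  obtain ⟨t, ht, rfl, rfl, rfl, rfl, rfl, rfl⟩ := quadRat_eq_quadRat h h' heq
  exact (isMonomialCoeffs_smul ht _ _ _ _ _ _).1 hm

lemma isMonomialType_comp_iff {g φ ψ : RatFunc F} (hg : ratDeg g = 2) (hφ : ratDeg φ = 1)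
    (hψ : ratDeg ψ = 1) : IsMonomialType (rcomp φ (rcomp g ψ)) ↔ IsMonomialType g := by
  obtain ⟨a, b, c, d, e, f, h, rfl⟩ := exists_quadRat_of_ratDeg hg
  obtain ⟨α, β, γ, δ, hdet, rfl⟩ := exists_linRat_of_ratDeg hφ
  obtain ⟨α', β', γ', δ', hdet', rfl⟩ := exists_linRat_of_ratDeg hψ
  have h1 := quadRes_comp_right_ne_zero hdet' h
  rw [rcomp_quadRat_linRat hdet' h, rcomp_linRat_quadRat hdet h1,
    isMonomialType_quadRat (quadRes_comp_left_ne_zero hdet h1), isMonomialType_quadRat h,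
    isMonomialCoeffs_comp_left hdet, isMonomialCoeffs_comp_right hdet']

/-- The relation on rational functions of degree two whose classes are counted. -/
def DegTwoRel (f g : {f : RatFunc F // ratDeg f = 2}) : Prop :=
  ∃ φ ψ : RatFunc F, ratDeg φ = 1 ∧ ratDeg ψ = 1 ∧
    (g : RatFunc F) = rcomp φ (rcomp (f : RatFunc F) ψ)

/-- Two rational functions of degree two have the same class. -/
def SameClass (f g : RatFunc F) : Prop :=
  ∃ (hf : ratDeg f = 2) (hg : ratDeg g = 2),
    Quot.mk DegTwoRel ⟨f, hf⟩ = Quot.mk DegTwoRel ⟨g, hg⟩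

lemma SameClass.symm {f g : RatFunc F} : SameClass f g → SameClass g f :=
  fun ⟨hf, hg, h⟩ => ⟨hg, hf, h.symm⟩

lemma SameClass.trans {f g k : RatFunc F} : SameClass f g → SameClass g k → SameClass f k :=
  fun ⟨hf, _, h⟩ ⟨_, hk, h'⟩ => ⟨hf, hk, h.trans h'⟩

lemma SameClass.comp_left (α β γ δ : F) {a b c d e f a' b' c' d' e' f' : F}
    (hdet : α * δ - β * γ ≠ 0) (h : quadRes a b c d e f ≠ 0)
    (ha : α * a + β * d = a') (hb : α * b + β * e = b') (hc : α * c + β * f = c')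
    (hd : γ * a + δ * d = d') (he : γ * b + δ * e = e') (hf : γ * c + δ * f = f') :
    SameClass (quadRat a b c d e f) (quadRat a' b' c' d' e' f') := by
  subst ha hb hc hd he hf
  refine ⟨ratDeg_quadRat h, ratDeg_quadRat (quadRes_comp_left_ne_zero hdet h),
    Quot.sound ⟨linRat α β γ δ, linRat 1 0 0 1, ratDeg_linRat hdet, ratDeg_linRat (by simp), ?_⟩⟩
  have hid := rcomp_quadRat_linRat (α := 1) (β := 0) (γ := 0) (δ := 1) (by simp) h
  simp only [one_pow, mul_one, mul_zero, ne_eq, OfNat.ofNat_ne_zero, not_false_eq_true, zero_pow,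
    add_zero, zero_add] at hid
  rw [hid, rcomp_linRat_quadRat hdet h]

lemma SameClass.comp_right (α β γ δ : F) {a b c d e f a' b' c' d' e' f' : F}
    (hdet : α * δ - β * γ ≠ 0) (h : quadRes a b c d e f ≠ 0)
    (ha : a * α ^ 2 + b * α * γ + c * γ ^ 2 = a')
    (hb : 2 * a * α * β + b * (α * δ + β * γ) + 2 * c * γ * δ = b')
    (hc : a * β ^ 2 + b * β * δ + c * δ ^ 2 = c')
    (hd : d * α ^ 2 + e * α * γ + f * γ ^ 2 = d')
    (he : 2 * d * α * β + e * (α * δ + β * γ) + 2 * f * γ * δ = e')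
    (hf : d * β ^ 2 + e * β * δ + f * δ ^ 2 = f') :
    SameClass (quadRat a b c d e f) (quadRat a' b' c' d' e' f') := by
  subst ha hb hc hd he hf
  have h' := quadRes_comp_right_ne_zero hdet h
  refine ⟨ratDeg_quadRat h, ratDeg_quadRat h',
    Quot.sound ⟨linRat 1 0 0 1, linRat α β γ δ, ratDeg_linRat (by simp), ratDeg_linRat hdet, ?_⟩⟩
  have hid := rcomp_linRat_quadRat (α := 1) (β := 0) (γ := 0) (δ := 1) (by simp) h'
  simp only [one_mul, zero_mul, add_zero, zero_add] at hid
  rw [rcomp_quadRat_linRat hdet h, hid]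

lemma four_ne_zero_of_two_ne_zero (h2 : (2 : F) ≠ 0) : (4 : F) ≠ 0 := by
  convert mul_ne_zero h2 h2 using 1
  norm_num

lemma sameClass_polynomial_of_two_ne_zero (h2 : (2 : F) ≠ 0) (k : F) :
    SameClass (quadRat 1 k 0 0 0 1) (quadRat 1 0 0 0 0 1) :=
  (SameClass.comp_right 1 (-k / 2) 0 1 (by simp) (by simp [quadRes]) (a' := 1) (b' := 0)
    (c' := -k ^ 2 / 4) (d' := 0) (e' := 0) (f' := 1) (by ring) (by field_simp; ring)
    (by have h4 := four_ne_zero_of_two_ne_zero h2; field_simp; ring)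
    (by ring) (by ring) (by ring)).trans
  (SameClass.comp_left 1 (k ^ 2 / 4) 0 1 (by simp) (by simp [quadRes])
    (by ring) (by ring) (by ring) (by ring) (by ring) (by ring))

lemma sameClass_polynomial_of_ne_zero {k : F} (hk : k ≠ 0) :
    SameClass (quadRat 1 k 0 0 0 1) (quadRat 1 1 0 0 0 1) :=
  (SameClass.comp_right k 0 0 1 (by simpa using hk) (by simp [quadRes]) (a' := k ^ 2)
    (b' := k ^ 2) (c' := 0) (d' := 0) (e' := 0) (f' := 1) (by ring) (by ring) (by ring)
    (by ring) (by ring) (by ring)).trans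
  (SameClass.comp_left (k ^ 2)⁻¹ 0 0 1 (by simpa using hk) (by simpa [quadRes] using hk)
    (by field_simp; ring) (by field_simp; ring) (by ring) (by ring) (by ring) (by ring))

lemma sameClass_add_div {n m t : F} (hm : m ≠ 0) (ht : t ≠ 0) (hn : n = m * t ^ 2) :
    SameClass (quadRat 1 0 n 0 1 0) (quadRat 1 0 m 0 1 0) := by
  subst hn
  refine (SameClass.comp_right t 0 0 1 (by simpa using ht) (by simp [quadRes, hm, ht])
    (a' := t ^ 2) (b' := 0) (c' := m * t ^ 2) (d' := 0) (e' := t) (f' := 0)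
    (by ring) (by ring) (by ring) (by ring) (by ring) (by ring)).trans
    (SameClass.comp_left (t ^ 2)⁻¹ 0 0 t⁻¹ (by simpa using ht) (by simp [quadRes, hm, ht])
      ?_ ?_ ?_ ?_ ?_ ?_) <;> field_simp <;> ring

lemma sameClass_add_inv_of_two_ne_zero (h2 : (2 : F) ≠ 0) :
    SameClass (quadRat 1 0 1 0 1 0) (quadRat (1 : F) 0 0 0 0 1) := by
  have h4 := four_ne_zero_of_two_ne_zero h2
  refine SameClass.symm ((SameClass.comp_right 1 (-1) 1 1 (by norm_num; exact h2)
    (by simp [quadRes]) (a' := 1) (b' := -2) (c' := 1) (d' := 1) (e' := 2) (f' := 1)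
    (by ring) (by ring) (by ring) (by ring) (by ring) (by ring)).trans
    (SameClass.comp_left 2⁻¹ 2⁻¹ (-4⁻¹) 4⁻¹ ?_ ?_ ?_ ?_ ?_ ?_ ?_ ?_))
  · have h : (2⁻¹ : F) * 4⁻¹ - 2⁻¹ * -4⁻¹ = 4⁻¹ := by field_simp; norm_num
    rw [h]
    exact inv_ne_zero h4
  · have h : quadRes (1 : F) (-2) 1 1 2 1 = 4 * 4 := by simp only [quadRes]; norm_num
    rw [h]
    exact mul_ne_zero h4 h4
  all_goals field_simp; try norm_num

lemma sameClass_add_inv_of_two_eq_zero (h2 : (2 : F) = 0) :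
    SameClass (quadRat 1 0 1 0 1 0) (quadRat (1 : F) 1 0 0 0 1) :=
  (SameClass.comp_left 0 1 1 0 (by simp) (by simp [quadRes]) (a' := 0) (b' := 1) (c' := 0)
    (d' := 1) (e' := 0) (f' := 1) (by ring) (by ring) (by ring) (by ring) (by ring)
    (by ring)).trans <|
  (SameClass.comp_right 1 1 0 1 (by simp) (by simp [quadRes]) (a' := 0) (b' := 1) (c' := 1)
    (d' := 1) (e' := 0) (f' := 0) (by ring) (by ring) (by ring) (by ring)
    (by linear_combination h2) (by linear_combination h2)).trans
  (SameClass.comp_right 0 1 1 0 (by simp) (by simp [quadRes])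
    (by ring) (by ring) (by ring) (by ring) (by ring) (by ring))

lemma exists_sameClass_denom_linear {a b c d e f : F} (h : quadRes a b c d e f ≠ 0) :
    ∃ a' b' c' e' f' : F, quadRes a' b' c' 0 e' f' ≠ 0 ∧
      SameClass (quadRat a b c d e f) (quadRat a' b' c' 0 e' f') := by
  by_cases ha : a = 0
  · subst ha
    have hdet : (0 : F) * 0 - 1 * 1 ≠ 0 := by simp
    have := quadRes_comp_left_ne_zero hdet h
    refine ⟨_, _, _, _, _, ?_, SameClass.comp_left 0 1 1 0 hdet h rfl rfl rfl (by ring) rfl rfl⟩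
    simpa using this
  · have hdet : (1 : F) * 1 - 0 * (-d / a) ≠ 0 := by simp
    have hd : -d / a * a + 1 * d = 0 := by field_simp; ring
    have := quadRes_comp_left_ne_zero hdet h
    rw [hd] at this
    exact ⟨_, _, _, _, _, this,
      SameClass.comp_left 1 0 (-d / a) 1 hdet h rfl rfl rfl hd rfl rfl⟩

/-- Every rational function of degree two is equivalent to a polynomial `X² + kX` or to a
function `X + n / X`. -/
lemma exists_sameClass_normal {g : RatFunc F} (hg : ratDeg g = 2) :
    (∃ k : F, SameClass g (quadRat 1 k 0 0 0 1)) ∨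
      ∃ n : F, n ≠ 0 ∧ SameClass g (quadRat 1 0 n 0 1 0) := by
  obtain ⟨a, b, c, d, e, f, h, rfl⟩ := exists_quadRat_of_ratDeg hg
  obtain ⟨a, b, c, e, f, h, hs⟩ := exists_sameClass_denom_linear h
  have ha : a ≠ 0 := by rintro rfl; simp [quadRes] at h
  by_cases he : e = 0
  · left
    subst he
    have hf : f ≠ 0 := by rintro rfl; simp [quadRes] at h
    refine ⟨b / a, hs.trans
      (SameClass.comp_left a⁻¹ (-c / (a * f)) 0 f⁻¹ (by simp [ha, hf]) h ?_ ?_ ?_ ?_ ?_ ?_)⟩ <;>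
      field_simp <;> ring
  · right
    have hc : a * (-f / e) ^ 2 + b * (-f / e) + c ≠ 0 := by
      intro h0
      apply h
      field_simp at h0
      simp only [quadRes]
      linear_combination a * h0
    generalize hn : a * (-f / e) ^ 2 + b * (-f / e) + c = n at hc
    refine ⟨n / a, div_ne_zero hc ha, hs.trans
      ((SameClass.comp_right 1 (-f / e) 0 1 (by simp) h (a' := a)
        (b' := 2 * a * (-f / e) + b) (c' := n) (d' := 0) (e' := e) (f' := 0)
        (by ring) (by ring) (by rw [← hn]; ring) (by ring) (by ring)
        (by field_simp; ring)).trans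
      (SameClass.comp_left a⁻¹ (-(2 * a * (-f / e) + b) / (a * e)) 0 e⁻¹ (by simp [ha, he])
        (by simp [quadRes, ha, he, hc]) ?_ ?_ ?_ ?_ ?_ ?_))⟩ <;> field_simp <;> ring

section Finite

variable [Fintype F]

lemma isSquare_of_two_eq_zero (h2 : (2 : F) = 0) (x : F) : IsSquare x :=
  FiniteField.isSquare_of_char_two
    (CharP.ringChar_of_prime_eq_zero Nat.prime_two (by exact_mod_cast h2)) x

lemma exists_eq_mul_sq_of_not_isSquare {n m : F} (hn : ¬ IsSquare n) (hm : ¬ IsSquare m) :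
    ∃ t : F, t ≠ 0 ∧ n = m * t ^ 2 := by
  classical
  have hn0 : n ≠ 0 := by rintro rfl; exact hn IsSquare.zero
  have hm0 : m ≠ 0 := by rintro rfl; exact hm IsSquare.zero
  have hsq : IsSquare (n * m) := by
    rw [← quadraticChar_one_iff_isSquare (mul_ne_zero hn0 hm0), map_mul,
      quadraticChar_neg_one_iff_not_isSquare.2 hn, quadraticChar_neg_one_iff_not_isSquare.2 hm]
    norm_num
  obtain ⟨s, hs⟩ := hsq
  have hs0 : s ≠ 0 := by rintro rfl; simp [hn0, hm0] at hs
  refine ⟨s / m, div_ne_zero hs0 hm0, ?_⟩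
  field_simp
  linear_combination hs

/-- There is a single class besides that of `X²`. -/
lemma exists_other_class : ∃ r : RatFunc F, ratDeg r = 2 ∧ ¬ IsMonomialType r ∧
    ∀ g : RatFunc F, ratDeg g = 2 → SameClass g (quadRat 1 0 0 0 0 1) ∨ SameClass g r := by
  by_cases h2 : (2 : F) = 0
  · have hres : quadRes (1 : F) 1 0 0 0 1 ≠ 0 := by simp [quadRes]
    refine ⟨quadRat 1 1 0 0 0 1, ratDeg_quadRat hres, ?_, fun g hg => ?_⟩
    · rw [isMonomialType_quadRat hres]
      intro h
      simpa using (h.2 h2).2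
    · rcases exists_sameClass_normal hg with ⟨k, hk⟩ | ⟨n, hn, hs⟩
      · by_cases hk0 : k = 0
        · subst hk0; exact Or.inl hk
        · exact Or.inr (hk.trans (sameClass_polynomial_of_ne_zero hk0))
      · obtain ⟨t, rfl⟩ := isSquare_of_two_eq_zero h2 n
        exact Or.inr ((hs.trans (sameClass_add_div one_ne_zero (left_ne_zero_of_mul hn)
          (by ring))).trans (sameClass_add_inv_of_two_eq_zero h2))
  · obtain ⟨m, hm⟩ := FiniteField.exists_nonsquare (F := F) fun hchar => h2 (by
      have := ringChar.Nat.cast_ringChar (R := F)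
      rw [hchar] at this
      exact_mod_cast this)
    have hm0 : m ≠ 0 := by rintro rfl; exact hm IsSquare.zero
    have hval : quadRes 1 0 m 0 1 0 = m := by simp [quadRes]
    have hres : quadRes 1 0 m 0 1 0 ≠ 0 := by rwa [hval]
    refine ⟨quadRat 1 0 m 0 1 0, ratDeg_quadRat hres, ?_, fun g hg => ?_⟩
    · rw [isMonomialType_quadRat hres]
      intro h
      exact hm (hval ▸ h.1)
    · rcases exists_sameClass_normal hg with ⟨k, hk⟩ | ⟨n, hn, hs⟩
      · exact Or.inl (hk.trans (sameClass_polynomial_of_two_ne_zero h2 k))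
      · by_cases hsq : IsSquare n
        · obtain ⟨t, rfl⟩ := hsq
          exact Or.inl ((hs.trans (sameClass_add_div one_ne_zero (left_ne_zero_of_mul hn)
            (by ring))).trans (sameClass_add_inv_of_two_ne_zero h2))
        · obtain ⟨t, ht, hnt⟩ := exists_eq_mul_sq_of_not_isSquare hsq hm
          exact Or.inr (hs.trans (sameClass_add_div hm0 ht hnt))

end Finite

end DegreeOneAndTwo

/-- For every prime power `q`, there are exactly two equivalence classes of rational
functions of degree 2 over `F_q`. -/
theorem count_deg_two (q : ℕ) (hq : IsPrimePow q)
    (F : Type*) [Field F] [Fintype F] (hF : Fintype.card F = q) :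
    ratEquivCount F 2 = 2 := by
  change Nat.card (Quot (DegTwoRel (F := F))) = 2
  obtain ⟨r, hr, hr', hall⟩ := exists_other_class (F := F)
  have hres : quadRes (1 : F) 0 0 0 0 1 ≠ 0 := by simp [quadRes]
  have hX : IsMonomialType (quadRat (1 : F) 0 0 0 0 1) :=
    (isMonomialType_quadRat hres).2 ⟨by simp [quadRes], by simp⟩
  let type : Quot (DegTwoRel (F := F)) → Prop :=
    Quot.lift (fun g => IsMonomialType g.1) (by
      rintro ⟨f, hf⟩ ⟨g, hg⟩ ⟨φ, ψ, hφ, hψ, rfl⟩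
      exact propext (isMonomialType_comp_iff hf hφ hψ).symm)
  let x : Quot (DegTwoRel (F := F)) := Quot.mk _ ⟨_, ratDeg_quadRat hres⟩
  let y : Quot (DegTwoRel (F := F)) := Quot.mk _ ⟨r, hr⟩
  have hx : type x := hX
  have hy : ¬ type y := hr'
  have hxy : x ≠ y := fun h => hy (h ▸ hx)
  refine Nat.card_eq_two_iff.2 ⟨x, y, hxy, Set.eq_univ_of_forall ?_⟩
  rintro ⟨g, hg⟩
  rcases hall g hg with ⟨_, _, h⟩ | ⟨_, _, h⟩
  · exact Or.inl h
  · exact Or.inr h
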